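/- Let μ be a probability measure on ℝ^d and σ > 0 with d_μ(z) ≥ σ for all z ∈ ℝ^d. Let F ⊂ ℝ^d be a closed nonempty set, x, y ∈ ℝ^d, and let γ ∈ Γ_F(x,y) be a geodesic, i.e. D_μ(γ) = D_{μ,F}(x,y). Then |γ| ≤ ((sup_{t ∈ [0,1]} d_μ((1−t)x + ty)) / σ)^β · ‖x − y‖. -/

import Mathlib

open MeasureTheory Metric Set ProbabilityTheory
open scoped ENNReal NNReal

noncomputable section

/-- Euclidean space `ℝ^d`. -/
abbrev Euc (d : ℕ) := EuclideanSpace ℝ (Fin d)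

/-- The pseudo-distance-to-measure `δ_{μ,u}(x) = inf {r > 0 : μ(B(x,r)) > u}`. -/
def pseudoDTM {d : ℕ} (μ : Measure (Euc d)) (u : ℝ) (x : Euc d) : ℝ :=
  sInf {r : ℝ | 0 < r ∧ u < (μ (ball x r)).toReal}

/-- The distance-to-measure `d_μ(x) = ((1/m) ∫₀^m δ_{μ,u}(x)^p du)^{1/p}`. -/
def dtm {d : ℕ} (m p : ℝ) (μ : Measure (Euc d)) (x : Euc d) : ℝ :=
  ((1 / m) * ∫ u in Ioc (0 : ℝ) m, pseudoDTM μ u x ^ p) ^ (1 / p)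

/-- A Lipschitz path. -/
def IsLipschitzPath {d : ℕ} (γ : ℝ → Euc d) : Prop := ∃ K, LipschitzWith K γ

/-- Euclidean length `|γ| = ∫₀¹ ‖γ'(t)‖ dt`. -/
def eucLength {d : ℕ} (γ : ℝ → Euc d) : ℝ := ∫ t in Icc (0 : ℝ) 1, ‖deriv γ t‖

/-- FDTM length `D_μ(γ) = ∫₀¹ d_μ(γ(t))^β ‖γ'(t)‖ dt`. -/
def fdtmLength {d : ℕ} (m p β : ℝ) (μ : Measure (Euc d)) (γ : ℝ → Euc d) : ℝ :=
  ∫ t in Icc (0 : ℝ) 1, dtm m p μ (γ t) ^ β * ‖deriv γ t‖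

/-- Admissible paths `Γ_F(x,y)`: Lipschitz paths from `x` to `y` which may leave the domain `F`
only along straight lines. -/
def AdmissiblePath {d : ℕ} (F : Set (Euc d)) (x y : Euc d) (γ : ℝ → Euc d) : Prop :=
  IsLipschitzPath γ ∧ γ 0 = x ∧ γ 1 = y ∧
    ∀ a b : ℝ, 0 ≤ a → b ≤ 1 →
      (∀ t ∈ Ioo a b, γ t ∉ F) →
      ∃ u : Euc d, ‖u‖ = 1 ∧
        ∀ᵐ t ∂(volume.restrict (Ioo a b)), deriv γ t = ‖deriv γ t‖ • u

/-- The Fermat distance-to-measure `D_{μ,F}(x,y) = inf_{γ ∈ Γ_F(x,y)} D_μ(γ)`. -/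
def fdtm {d : ℕ} (m p β : ℝ) (μ : Measure (Euc d)) (F : Set (Euc d)) (x y : Euc d) : ℝ :=
  sInf {L : ℝ | ∃ γ : ℝ → Euc d, AdmissiblePath F x y γ ∧ L = fdtmLength m p β μ γ}

/-- A geodesic: an admissible path realizing the FDTM. -/
def IsGeodesic {d : ℕ} (m p β : ℝ) (μ : Measure (Euc d)) (F : Set (Euc d)) (x y : Euc d)
    (γ : ℝ → Euc d) : Prop :=
  AdmissiblePath F x y γ ∧ fdtmLength m p β μ γ = fdtm m p β μ F x y

/-- FDTM length of the straight segment `[x,y]`. -/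
def segFDTM {d : ℕ} (m p β : ℝ) (μ : Measure (Euc d)) (x y : Euc d) : ℝ :=
  ‖x - y‖ * ∫ t in Icc (0 : ℝ) 1, dtm m p μ ((1 - t) • x + t • y) ^ β

/-- The explicit constant `λ = 2·c·ρ^{β+1}/(ρ−1)` with `c = (16·5^β + 1152·165^β)/m^{2+β}`
and `ρ = 1 + 32/m`. -/
def fdtmConst (m β : ℝ) : ℝ :=
  2 * ((16 * (5 : ℝ) ^ β + 1152 * (165 : ℝ) ^ β) / m ^ (2 + β)) * (1 + 32 / m) ^ (β + 1) /
    ((1 + 32 / m) - 1)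

/-- Support of a measure: points all of whose neighborhoods have positive mass. -/
def measSupport {d : ℕ} (μ : Measure (Euc d)) : Set (Euc d) :=
  {x | ∀ r : ℝ, 0 < r → 0 < μ (ball x r)}

/-- `(a,b)`-standard measure: `μ(B(x,r)) ≥ a·r^b` for `x ∈ supp(μ)` and `0 < r ≤ a^{-1/b}`. -/
def IsStandard {d : ℕ} (μ : Measure (Euc d)) (a b : ℝ) : Prop :=
  ∀ x ∈ measSupport μ, ∀ r : ℝ, 0 < r → r ≤ a ^ (-(1 / b)) → a * r ^ b ≤ (μ (ball x r)).toReal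

lemma pseudoDTM_nonneg {d : ℕ} (μ : Measure (Euc d)) (u : ℝ) (x : Euc d) :
    0 ≤ pseudoDTM μ u x :=
  Real.sInf_nonneg fun _ h => h.1.le

lemma bddBelow_pseudoDTM_set {d : ℕ} (μ : Measure (Euc d)) (u : ℝ) (x : Euc d) :
    BddBelow {r : ℝ | 0 < r ∧ u < (μ (ball x r)).toReal} :=
  ⟨0, fun _ h => h.1.le⟩

lemma exists_pos_lt_measure_ball {d : ℕ} (μ : Measure (Euc d)) [IsProbabilityMeasure μ]
    {u : ℝ} (hu : u < 1) (x : Euc d) : ∃ r : ℝ, 0 < r ∧ u < (μ (ball x r)).toReal := by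
  have hmono : Monotone fun n : ℕ => ball x (n : ℝ) := fun _ _ h =>
    ball_subset_ball (by exact_mod_cast h)
  have hlim := tendsto_measure_iUnion_atTop (μ := μ) hmono
  rw [iUnion_ball_nat, measure_univ] at hlim
  have hlim' := (ENNReal.tendsto_toReal ENNReal.one_ne_top).comp hlim
  rw [ENNReal.toReal_one] at hlim'
  obtain ⟨n, hn, hn'⟩ :=
    ((hlim'.eventually (lt_mem_nhds hu)).and (Filter.eventually_gt_atTop 0)).exists
  exact ⟨n, by exact_mod_cast hn', hn⟩

lemma pseudoDTM_le_add_dist {d : ℕ} (μ : Measure (Euc d)) [IsProbabilityMeasure μ]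
    {u : ℝ} (hu : u < 1) (x y : Euc d) : pseudoDTM μ u x ≤ pseudoDTM μ u y + dist x y := by
  rw [← sub_le_iff_le_add]
  refine le_csInf (exists_pos_lt_measure_ball μ hu y) fun r hr => ?_
  rw [sub_le_iff_le_add]
  refine csInf_le (bddBelow_pseudoDTM_set μ u x) ⟨by linarith [hr.1, dist_nonneg (x := x) (y := y)],
    hr.2.trans_le (ENNReal.toReal_mono (measure_ne_top _ _) (measure_mono ?_))⟩
  exact ball_subset_ball' (by rw [dist_comm])

lemma continuous_pseudoDTM {d : ℕ} (μ : Measure (Euc d)) [IsProbabilityMeasure μ]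
    {u : ℝ} (hu : u < 1) : Continuous (pseudoDTM μ u) :=
  (LipschitzWith.of_le_add fun x y => pseudoDTM_le_add_dist μ hu x y).continuous

lemma pseudoDTM_mono {d : ℕ} (μ : Measure (Euc d)) [IsProbabilityMeasure μ]
    {u v : ℝ} (huv : u ≤ v) (hv : v < 1) (x : Euc d) : pseudoDTM μ u x ≤ pseudoDTM μ v x :=
  csInf_le_csInf (bddBelow_pseudoDTM_set μ u x) (exists_pos_lt_measure_ball μ hv x)
    fun _ hr => ⟨hr.1, huv.trans_lt hr.2⟩

lemma dtm_nonneg {d : ℕ} {m : ℝ} (hm : 0 ≤ m) (p : ℝ) (μ : Measure (Euc d)) (x : Euc d) :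
    0 ≤ dtm m p μ x :=
  Real.rpow_nonneg (mul_nonneg (by positivity)
    (integral_nonneg fun _ => Real.rpow_nonneg (pseudoDTM_nonneg _ _ _) _)) _

lemma continuous_dtm {d : ℕ} {m p : ℝ} (hm : m < 1) (hp : 0 ≤ p)
    (μ : Measure (Euc d)) [IsProbabilityMeasure μ] : Continuous (dtm m p μ) := by
  refine Continuous.rpow_const (continuous_const.mul ?_) fun _ => Or.inr (by positivity)
  refine continuous_iff_continuousAt.2 fun x₀ => ?_
  refine continuousAt_of_dominated (bound := fun _ => (pseudoDTM μ m x₀ + 1) ^ p)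
    (.of_forall fun x => ?_) ?_ (integrable_const _) ?_
  · refine ((aemeasurable_restrict_of_monotoneOn measurableSet_Ioc ?_).pow_const
      p).aestronglyMeasurable
    exact fun u _ v hv huv => pseudoDTM_mono μ huv (hv.2.trans_lt hm) x
  · filter_upwards [ball_mem_nhds x₀ one_pos] with x hx
    refine (ae_restrict_iff' measurableSet_Ioc).2 (.of_forall fun u hu => ?_)
    rw [Real.norm_of_nonneg (Real.rpow_nonneg (pseudoDTM_nonneg _ _ _) _)]
    refine Real.rpow_le_rpow (pseudoDTM_nonneg _ _ _) ?_ hp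
    linarith [pseudoDTM_mono μ hu.2 hm x, pseudoDTM_le_add_dist μ hm x x₀, mem_ball.1 hx]
  · refine (ae_restrict_iff' measurableSet_Ioc).2 (.of_forall fun u hu => ?_)
    exact ((continuous_pseudoDTM μ (hu.2.trans_lt hm)).rpow_const fun _ => Or.inr hp).continuousAt

lemma IsLipschitzPath.integrableOn_mul_norm_deriv {d : ℕ} {γ : ℝ → Euc d}
    (hγ : IsLipschitzPath γ) {f : ℝ → ℝ} (hf : Continuous f) :
    IntegrableOn (fun t => f t * ‖deriv γ t‖) (Icc 0 1) := by
  obtain ⟨K, hK⟩ := hγ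
  refine Integrable.mul_bdd (c := K) (hf.continuousOn.integrableOn_compact isCompact_Icc)
    (measurable_deriv γ).norm.aestronglyMeasurable (.of_forall fun t => ?_)
  rw [norm_norm]
  exact norm_deriv_le_of_lipschitz hK

lemma fdtmLength_nonneg {d : ℕ} {m : ℝ} (hm : 0 ≤ m) (p β : ℝ) (μ : Measure (Euc d))
    (γ : ℝ → Euc d) : 0 ≤ fdtmLength m p β μ γ :=
  integral_nonneg fun _ => mul_nonneg (Real.rpow_nonneg (dtm_nonneg hm _ _ _) _) (norm_nonneg _)

lemma fdtm_le_fdtmLength {d : ℕ} {m : ℝ} (hm : 0 ≤ m) (p β : ℝ) (μ : Measure (Euc d))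
    {F : Set (Euc d)} {x y : Euc d} {γ : ℝ → Euc d} (hγ : AdmissiblePath F x y γ) :
    fdtm m p β μ F x y ≤ fdtmLength m p β μ γ :=
  csInf_le ⟨0, by rintro _ ⟨γ, -, rfl⟩; exact fdtmLength_nonneg hm p β μ γ⟩ ⟨γ, hγ, rfl⟩

lemma rpow_mul_eucLength_le_fdtmLength {d : ℕ} {m p β σ : ℝ} (hm : m < 1) (hp : 0 ≤ p)
    (hβ : 0 ≤ β) (μ : Measure (Euc d)) [IsProbabilityMeasure μ] (hσ : 0 ≤ σ)
    (hσle : ∀ z : Euc d, σ ≤ dtm m p μ z) {γ : ℝ → Euc d} (hγ : IsLipschitzPath γ) :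
    σ ^ β * eucLength γ ≤ fdtmLength m p β μ γ := by
  have hcont : Continuous γ := hγ.choose_spec.continuous
  rw [eucLength, ← integral_const_mul]
  refine integral_mono (hγ.integrableOn_mul_norm_deriv continuous_const)
    (hγ.integrableOn_mul_norm_deriv
      (((continuous_dtm hm hp μ).comp hcont).rpow_const fun _ => Or.inr hβ)) fun t => ?_
  exact mul_le_mul_of_nonneg_right (Real.rpow_le_rpow hσ (hσle _) hβ) (norm_nonneg _)

lemma hasDerivAt_segment {d : ℕ} (x y : Euc d) (t : ℝ) :
    HasDerivAt (fun t : ℝ => (1 - t) • x + t • y) (y - x) t := by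
  have h := (((hasDerivAt_id t).const_sub 1).smul_const x).add ((hasDerivAt_id t).smul_const y)
  exact h.congr_deriv (by module)

/-- The segment is admissible as soon as the ambient space contains a unit vector, which is used
when its endpoints agree. -/
lemma admissiblePath_segment {d : ℕ} (F : Set (Euc d)) (x y : Euc d) (h : ∃ u : Euc d, ‖u‖ = 1) :
    AdmissiblePath F x y (fun t : ℝ => (1 - t) • x + t • y) := by
  refine ⟨⟨‖y - x‖₊, ?_⟩, by simp, by simp, fun a b _ _ _ => ?_⟩
  · refine lipschitzWith_of_nnnorm_deriv_le (fun t => (hasDerivAt_segment x y t).differentiableAt)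
      fun t => ?_
    rw [(hasDerivAt_segment x y t).deriv]
  · rcases eq_or_ne (y - x) 0 with hxy | hxy
    · obtain ⟨u, hu⟩ := h
      refine ⟨u, hu, .of_forall fun t => ?_⟩
      rw [(hasDerivAt_segment x y t).deriv, hxy]
      simp
    · refine ⟨‖y - x‖⁻¹ • (y - x), norm_smul_inv_norm hxy, .of_forall fun t => ?_⟩
      rw [(hasDerivAt_segment x y t).deriv, smul_inv_smul₀ (norm_ne_zero_iff.2 hxy)]

lemma Continuous.le_biSup_Icc {f : ℝ → ℝ} (hf : Continuous f) {a b t : ℝ} (ht : t ∈ Icc a b) :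
    f t ≤ ⨆ s ∈ Icc a b, f s := by
  obtain ⟨C, hC⟩ := (isCompact_Icc (a := a) (b := b)).bddAbove_image hf.continuousOn
  refine le_ciSup_of_le ⟨max C 0, ?_⟩ t (ciSup_pos (f := fun _ => f t) ht).ge
  rintro _ ⟨s, rfl⟩
  exact Real.iSup_le (fun hs => (hC (mem_image_of_mem f hs)).trans (le_max_left _ _))
    (le_max_right _ _)

lemma fdtmLength_segment_le {d : ℕ} {m p β : ℝ} (hm : m ∈ Ioo (0 : ℝ) 1) (hp : 0 ≤ p)
    (hβ : 0 ≤ β) (μ : Measure (Euc d)) [IsProbabilityMeasure μ] (x y : Euc d) :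
    fdtmLength m p β μ (fun t : ℝ => (1 - t) • x + t • y) ≤
      (⨆ t ∈ Icc (0 : ℝ) 1, dtm m p μ ((1 - t) • x + t • y)) ^ β * ‖x - y‖ := by
  have hcont : Continuous fun t : ℝ => dtm m p μ ((1 - t) • x + t • y) :=
    (continuous_dtm hm.2 hp μ).comp (by fun_prop)
  simp only [fdtmLength, (hasDerivAt_segment x y _).deriv, norm_sub_rev y x]
  refine (setIntegral_mono_on (((hcont.rpow_const fun _ => Or.inr hβ).mul
    continuous_const).continuousOn.integrableOn_compact isCompact_Icc)
    (integrableOn_const (by simp)) measurableSet_Icc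
    fun t ht => mul_le_mul_of_nonneg_right (Real.rpow_le_rpow (dtm_nonneg hm.1.le _ _ _)
      (hcont.le_biSup_Icc ht) hβ) (norm_nonneg _)).trans ?_
  simp

theorem eucLength_geodesic_le_of_dtm_lower_bound {d : ℕ} (m p β : ℝ)
    (hm : m ∈ Set.Ioo (0 : ℝ) 1) (hp : 1 ≤ p) (hβ : 1 ≤ β)
    (μ : Measure (Euc d)) [IsProbabilityMeasure μ]
    (σ : ℝ) (hσ : 0 < σ) (hσle : ∀ z : Euc d, σ ≤ dtm m p μ z)
    (F : Set (Euc d)) (hF : IsClosed F) (hFne : F.Nonempty) (x y : Euc d)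
    (γ : ℝ → Euc d) (hγ : IsGeodesic m p β μ F x y γ) :
    eucLength γ ≤
      ((⨆ t ∈ Icc (0 : ℝ) 1, dtm m p μ ((1 - t) • x + t • y)) / σ) ^ β * ‖x - y‖ := by
  have hp0 : 0 ≤ p := zero_le_one.trans hp
  have hβ0 : 0 ≤ β := zero_le_one.trans hβ
  obtain ⟨hadm, hmin⟩ := hγ
  have hunit : ∃ u : Euc d, ‖u‖ = 1 := by
    obtain ⟨u, hu, -⟩ := hadm.2.2.2 0 0 le_rfl zero_le_one (by simp)
    exact ⟨u, hu⟩
  have hlower := rpow_mul_eucLength_le_fdtmLength hm.2 hp0 hβ0 μ hσ.le hσle hadm.1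
  have hseg := fdtm_le_fdtmLength hm.1.le p β μ (admissiblePath_segment F x y hunit)
  have hupper := fdtmLength_segment_le hm hp0 hβ0 μ x y
  have hsup : 0 ≤ ⨆ t ∈ Icc (0 : ℝ) 1, dtm m p μ ((1 - t) • x + t • y) :=
    Real.iSup_nonneg fun _ => Real.iSup_nonneg fun _ => dtm_nonneg hm.1.le _ _ _
  rw [Real.div_rpow hsup hσ.le, div_mul_eq_mul_div, le_div_iff₀' (Real.rpow_pos_of_pos hσ β)]
  exact hlower.trans (hmin.le.trans (hseg.trans hupper))

end
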